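/- Let X be a δ-hyperbolic metric space and let x_0, x_1, …, x_n be a (C,D)-chain in X with D ≥ 2C + 4δ + 1. Then for all 0 ≤ i ≤ n one has (x_0, x_n)_{x_i} ≤ C + 2δ. -/

import Mathlib

open Filter MeasureTheory
open scoped ENNReal NNReal Classical

noncomputable section

/-- The Gromov product `(x,z)_a`. -/
def gromov {X : Type*} [MetricSpace X] (x z a : X) : ℝ :=
  (dist a x + dist a z - dist x z) / 2

/-- `X` is `δ`-hyperbolic. -/
def IsDeltaHyperbolic (X : Type*) [MetricSpace X] (δ : ℝ) : Prop :=
  ∀ x y z a : X, min (gromov x y a) (gromov y z a) - δ ≤ gromov x z a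

/-- An isometry `g` of `X` is loxodromic: `d(o, g^n o)/n` converges to a positive limit. -/
def Loxodromic {X : Type*} [MetricSpace X] (o : X) (g : X ≃ᵢ X) : Prop :=
  ∃ L : ℝ, 0 < L ∧ Tendsto (fun n : ℕ => dist o ((g ^ n) o) / n) atTop (nhds L)

/-- Two isometries have disjoint fixed point sets at infinity:
for all signs `ε, ε' ∈ {1, -1}`, `sup_{n,m ≥ 1} (u^{εn}·o, v^{ε'm}·o)_o < ∞`. -/
def DisjointFixedPointsAtInfinity {X : Type*} [MetricSpace X] (o : X) (u v : X ≃ᵢ X) : Prop :=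
  ∀ ε ε' : ℤ, (ε = 1 ∨ ε = -1) → (ε' = 1 ∨ ε' = -1) →
    ∃ B : ℝ, ∀ n m : ℕ, 1 ≤ n → 1 ≤ m →
      gromov ((u ^ (ε * (n : ℤ))) o) ((v ^ (ε' * (m : ℤ))) o) o ≤ B

/-- A (discrete) probability measure on the isometry group of `X` is non-elementary if
the semigroup generated by its support contains two loxodromic elements with disjoint
fixed point sets at infinity. -/
def NonElementary {X : Type*} [MetricSpace X] (o : X) (μ : PMF (X ≃ᵢ X)) : Prop :=
  ∃ u v : X ≃ᵢ X,
    u ∈ Subsemigroup.closure μ.support ∧ v ∈ Subsemigroup.closure μ.support ∧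
      Loxodromic o u ∧ Loxodromic o v ∧ DisjointFixedPointsAtInfinity o u v

/-- The random walk `Z_n = g_0 g_1 ⋯ g_{n-1}`. -/
def RW {G : Type*} [Group G] {Ω : Type*} (g : ℕ → Ω → G) (n : ℕ) (ω : Ω) : G :=
  ((List.range n).map fun i => g i ω).prod

/-- The increments `g_i` are i.i.d. with (discrete) law `μ`: the cylinder events have
the product probabilities. -/
def IsIIDWalk {G Ω : Type*} [MeasurableSpace Ω] (P : Measure Ω) (μ : PMF G)
    (g : ℕ → Ω → G) : Prop :=
  ∀ (n : ℕ) (a : ℕ → G),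
    P {ω | ∀ i < n, g i ω = a i} = ∏ i ∈ Finset.range n, μ (a i)

/-- `x_0, …, x_n` is a `(C,D)`-chain. -/
def GromovChain {X : Type*} [MetricSpace X] (C D : ℝ) (x : ℕ → X) (n : ℕ) : Prop :=
  (∀ i : ℕ, 0 < i → i < n → gromov (x (i - 1)) (x (i + 1)) (x i) ≤ C) ∧
    ∀ i : ℕ, i < n → D ≤ dist (x i) (x (i + 1))

theorem gromov_comm {X : Type*} [MetricSpace X] (x z a : X) : gromov x z a = gromov z x a := by
  simp only [gromov, dist_comm x z]
  ring

theorem gromov_add_gromov {X : Type*} [MetricSpace X] (x a b : X) :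
    gromov x b a + gromov x a b = dist a b := by
  simp only [gromov, dist_comm x, dist_comm b a]
  ring

theorem gromov_base_left {X : Type*} [MetricSpace X] (x a : X) : gromov a x a = 0 := by
  simp [gromov]

theorem GromovChain.reverse {X : Type*} [MetricSpace X] {C D : ℝ} {x : ℕ → X} {n : ℕ}
    (hx : GromovChain C D x n) : GromovChain C D (fun i => x (n - i)) n := by
  refine ⟨fun i hi hin => ?_, fun i hin => ?_⟩
  · have h := hx.1 (n - i) (by omega) (by omega)
    rw [gromov_comm] at h
    have h₁ : n - (i - 1) = n - i + 1 := by omega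
    have h₂ : n - (i + 1) = n - i - 1 := by omega
    simpa only [h₁, h₂] using h
  · have h := hx.2 (n - (i + 1)) (by omega)
    rw [dist_comm] at h
    have h₁ : n - (i + 1) + 1 = n - i := by omega
    simpa only [h₁] using h

/-- If the product `(y, z)_a` is small and `(z, w)_a` is large, then `(y, w)_a` is small. -/
theorem IsDeltaHyperbolic.gromov_le {X : Type*} [MetricSpace X] {δ c : ℝ}
    (hX : IsDeltaHyperbolic X δ) {y z w a : X} (h : gromov y z a ≤ c)
    (hlarge : c + δ < gromov w z a) : gromov y w a ≤ c + δ := by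
  have := hX y w z a
  rcases min_choice (gromov y w a) (gromov w z a) with h' | h' <;> rw [h'] at this <;> linarith

theorem GromovChain.gromov_zero_succ_le {X : Type*} [MetricSpace X] {δ C D : ℝ} (hδ : 0 ≤ δ)
    (hX : IsDeltaHyperbolic X δ) (hC : 0 ≤ C) (hD : 2 * C + 4 * δ + 1 ≤ D)
    {n : ℕ} {x : ℕ → X} (hx : GromovChain C D x n) (k : ℕ) (hk : k < n) :
    gromov (x 0) (x (k + 1)) (x k) ≤ C + δ := by
  induction k with
  | zero =>
    rw [gromov_base_left]
    positivity
  | succ k ih =>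
    have hC' := hx.1 (k + 1) k.succ_pos hk
    rw [Nat.add_sub_cancel, gromov_comm] at hC'
    rw [gromov_comm]
    refine hX.gromov_le hC' ?_
    linarith [ih (by omega), gromov_add_gromov (x 0) (x k) (x (k + 1)), hx.2 k (by omega)]

/-- **Lemma 3.7 (alignment along a chain).** -/
theorem chain_alignment
    {X : Type*} [MetricSpace X] {δ : ℝ} (hδ : 0 ≤ δ) (hX : IsDeltaHyperbolic X δ)
    (C D : ℝ) (hC : 0 ≤ C) (hD : 2 * C + 4 * δ + 1 ≤ D)
    (n : ℕ) (x : ℕ → X) (hx : GromovChain C D x n) :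
    ∀ i : ℕ, i ≤ n → gromov (x 0) (x n) (x i) ≤ C + 2 * δ := by
  intro i hi
  rcases hi.eq_or_lt with rfl | hi
  · rw [gromov_comm, gromov_base_left]
    positivity
  · have hleft := hx.gromov_zero_succ_le hδ hX hC hD i hi
    have hright := hx.reverse.gromov_zero_succ_le hδ hX hC hD (n - (i + 1)) (by omega)
    have h₁ : n - (n - (i + 1) + 1) = i := by omega
    have h₂ : n - (n - (i + 1)) = i + 1 := by omega
    simp only [h₁, h₂, Nat.sub_zero] at hright
    have := hX.gromov_le (w := x n) hleft <| by
      linarith [gromov_add_gromov (x n) (x i) (x (i + 1)), hx.2 i hi]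
    linarith

end
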